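/- There exists an absolute constant C such that, for all reals δ, ε ∈ (0,1) and all nonnegative integers d, m, n, r satisfying r ≥ 2 and 1 ≤ m ≤ (1−δ)·C(n,2), the probability that the uniformly random graph G(n,m) is not (d,r,ε)-rigid is at most (Cr/ε)·( ((d+1)/δ + r)·√(n/m) + (n/m)^{1/4} ). -/

import Mathlib

open scoped Classical
open Filter

noncomputable section

/-- The possible edges of a graph on vertex set `Fin n`. -/
abbrev EdgeType (n : ℕ) := {e : Sym2 (Fin n) // ¬ e.IsDiag}

/-- A graph on vertex set `Fin n`, identified with its edge set. -/
abbrev LabeledGraph (n : ℕ) := Finset (EdgeType n)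

/-- The size of the `r`-cut given by `φ` in `G`. -/
def cutSize {n r : ℕ} (φ : Fin n → Fin r) (G : LabeledGraph n) : ℕ :=
  (G.filter fun e => ¬ (Sym2.map φ (e : Sym2 (Fin n))).IsDiag).card

/-- The maximum size of an `r`-cut of `G`. -/
def maxCut (n r : ℕ) (G : LabeledGraph n) : ℕ :=
  Finset.univ.sup fun φ : Fin n → Fin r => cutSize φ G

/-- The deficit of the `r`-cut `φ` in `G`. -/
def deficit {n : ℕ} (r : ℕ) (φ : Fin n → Fin r) (G : LabeledGraph n) : ℕ :=
  maxCut n r G - cutSize φ G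

/-- The set of pairs of `(d,r)`-equivalent vertices of `G`: unordered pairs of distinct
vertices lying in the same part of every `r`-cut of `G` with deficit at most `d`. -/
def eqPairs {n : ℕ} (d r : ℕ) (G : LabeledGraph n) : Finset (EdgeType n) :=
  Finset.univ.filter fun e =>
    ∀ φ : Fin n → Fin r, deficit r φ G ≤ d → (Sym2.map φ (e : Sym2 (Fin n))).IsDiag

/-- `G` is `(d,r,ε)`-rigid: there are at least `((1-ε)/r) C(n,2)` pairs of `(d,r)`-equivalent
vertices. -/
def Rigid {n : ℕ} (d r : ℕ) (ε : ℝ) (G : LabeledGraph n) : Prop :=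
  ((1 - ε) / r) * (n.choose 2 : ℝ) ≤ ((eqPairs d r G).card : ℝ)

/-- Probability of the event `A` under the uniform random graph `G(n,m)`. -/
def prGnm (n m : ℕ) (A : LabeledGraph n → Prop) : ℝ :=
  ((Finset.univ.filter fun G : LabeledGraph n => G.card = m ∧ A G).card : ℝ) /
    ((Finset.univ.filter fun G : LabeledGraph n => G.card = m).card : ℝ)

section Slice

/-- The average of `f` over the `m`-element subsets of a finite type. -/
def sliceAvg {α : Type*} [Fintype α] (m : ℕ) (f : Finset α → ℝ) : ℝ :=
  (∑ G ∈ (Finset.univ : Finset α).powersetCard m, f G) / ((Fintype.card α).choose m : ℝ)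

theorem choose_mul_pow_le {N m k : ℕ} (hm : m ≤ N) (hk : k ≤ N) {p : ℝ}
    (hp0 : 0 ≤ p) (hp1 : p ≤ 1) (hp : N * p = m) :
    (N.choose k : ℝ) * p ^ k * (1 - p) ^ (N - k) ≤ N.choose m * p ^ m * (1 - p) ^ (N - m) := by
  have hq : 0 ≤ 1 - p := by linarith
  have ratio : ∀ j, j < N → ((j : ℝ) + 1) * N.choose (j + 1) = (N - j) * N.choose j := by
    intro j hj
    have := Nat.choose_succ_right_eq N j
    have h2 : ((N - j : ℕ) : ℝ) = N - j := by rw [Nat.cast_sub hj.le]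
    rw [← h2]
    exact_mod_cast (by linarith : (j + 1) * N.choose (j + 1) = (N - j) * N.choose j)
  have pos : ∀ j : ℕ, (0 : ℝ) < j + 1 := fun j => by positivity
  have up : ∀ j, j < m → (N.choose j : ℝ) * p ^ j * (1 - p) ^ (N - j) ≤
      N.choose (j + 1) * p ^ (j + 1) * (1 - p) ^ (N - (j + 1)) := by
    intro j hj
    have hjN : j < N := by omega
    have hjm : (j : ℝ) + 1 ≤ m := by exact_mod_cast hj
    have key : (N.choose j : ℝ) * (1 - p) ≤ N.choose (j + 1) * p := by
      refine le_of_mul_le_mul_left ?_ (pos j)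
      rw [← mul_assoc _ (N.choose (j + 1) : ℝ), ratio j hjN]
      have : 0 ≤ ((N - j) * p - (j + 1) * (1 - p)) * (N.choose j : ℝ) :=
        mul_nonneg (by nlinarith) (by positivity)
      nlinarith
    rw [show N - j = N - (j + 1) + 1 by omega, pow_succ, pow_succ]
    calc _ = (N.choose j : ℝ) * (1 - p) * (p ^ j * (1 - p) ^ (N - (j + 1))) := by ring
      _ ≤ (N.choose (j + 1) * p) * (p ^ j * (1 - p) ^ (N - (j + 1))) := by gcongr
      _ = _ := by ring
  have down : ∀ j, m ≤ j → j < N →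
      (N.choose (j + 1) : ℝ) * p ^ (j + 1) * (1 - p) ^ (N - (j + 1)) ≤
        N.choose j * p ^ j * (1 - p) ^ (N - j) := by
    intro j hj hjN
    have hjm : (m : ℝ) ≤ j := by exact_mod_cast hj
    have key : (N.choose (j + 1) : ℝ) * p ≤ N.choose j * (1 - p) := by
      refine le_of_mul_le_mul_left ?_ (pos j)
      rw [← mul_assoc _ (N.choose (j + 1) : ℝ), ratio j hjN]
      have : 0 ≤ ((j + 1) * (1 - p) - (N - j) * p) * (N.choose j : ℝ) :=
        mul_nonneg (by nlinarith) (by positivity)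
      nlinarith
    rw [show N - j = N - (j + 1) + 1 by omega, pow_succ, pow_succ]
    calc _ = (N.choose (j + 1) * p) * (p ^ j * (1 - p) ^ (N - (j + 1))) := by ring
      _ ≤ (N.choose j : ℝ) * (1 - p) * (p ^ j * (1 - p) ^ (N - (j + 1))) := by gcongr
      _ = _ := by ring
  rcases le_total k m with h | h
  · induction h using Nat.decreasingInduction with
    | self => exact le_rfl
    | of_succ j hj ih => exact (up j hj).trans (ih (by omega))
  · induction k, h using Nat.le_induction with
    | base => exact le_rfl
    | succ j hj ih => exact (down j hj (by omega)).trans (ih (by omega))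

theorem one_le_succ_mul_choose_mul_pow {N m : ℕ} (hm : m ≤ N) {p : ℝ}
    (hp0 : 0 ≤ p) (hp1 : p ≤ 1) (hp : N * p = m) :
    1 ≤ ((N : ℝ) + 1) * (N.choose m * p ^ m * (1 - p) ^ (N - m)) := by
  have h := add_pow p (1 - p) N
  rw [add_sub_cancel, one_pow] at h
  calc (1 : ℝ) = _ := h
    _ ≤ ∑ _k ∈ Finset.range (N + 1), (N.choose m * p ^ m * (1 - p) ^ (N - m) : ℝ) := by
        refine Finset.sum_le_sum fun k hk => ?_
        have := choose_mul_pow_le hm (by simpa [Nat.lt_succ_iff] using hk) hp0 hp1 hp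
        linarith
    _ = _ := by simp

variable {α : Type*} [Fintype α]

theorem card_of_mem_slice {m : ℕ} {G : Finset α}
    (hG : G ∈ (Finset.univ : Finset α).powersetCard m) : G.card = m :=
  (Finset.mem_powersetCard.1 hG).2

theorem sliceAvg_mono {m : ℕ} {f g : Finset α → ℝ} (h : ∀ G, G.card = m → f G ≤ g G) :
    sliceAvg m f ≤ sliceAvg m g := by
  unfold sliceAvg
  gcongr with G hG
  exact h G (card_of_mem_slice hG)

theorem sliceAvg_sub (m : ℕ) (f g : Finset α → ℝ) :
    sliceAvg m (fun G => f G - g G) = sliceAvg m f - sliceAvg m g := by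
  simp [sliceAvg, Finset.sum_sub_distrib, sub_div]

theorem sliceAvg_add (m : ℕ) (f g : Finset α → ℝ) :
    sliceAvg m (fun G => f G + g G) = sliceAvg m f + sliceAvg m g := by
  simp [sliceAvg, Finset.sum_add_distrib, add_div]

theorem sliceAvg_mul_const (m : ℕ) (f : Finset α → ℝ) (c : ℝ) :
    sliceAvg m (fun G => f G * c) = sliceAvg m f * c := by
  simp only [sliceAvg, ← Finset.sum_mul]
  ring

theorem sliceAvg_div_const (m : ℕ) (f : Finset α → ℝ) (c : ℝ) :
    sliceAvg m (fun G => f G / c) = sliceAvg m f / c := by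
  simpa [div_eq_mul_inv] using sliceAvg_mul_const m f c⁻¹

theorem sliceAvg_const {m : ℕ} (hm : m ≤ Fintype.card α) (c : ℝ) :
    sliceAvg (α := α) m (fun _ => c) = c := by
  have : ((Fintype.card α).choose m : ℝ) ≠ 0 := by
    exact_mod_cast (Nat.choose_pos hm).ne'
  simp [sliceAvg, Finset.card_powersetCard, this]

theorem sliceAvg_sum {β : Type*} (s : Finset β) (m : ℕ) (f : β → Finset α → ℝ) :
    sliceAvg m (fun G => ∑ b ∈ s, f b G) = ∑ b ∈ s, sliceAvg m (f b) := by
  simp only [sliceAvg, ← Finset.sum_div]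
  rw [Finset.sum_comm]

/-- The moment generating function of a linear statistic of a uniformly random `m`-set exceeds
that of the corresponding product measure by at most a polynomial factor. -/
theorem sliceAvg_prod_le [DecidableEq α] {m : ℕ} (hm : m ≤ Fintype.card α) {p : ℝ}
    (hp0 : 0 ≤ p) (hp1 : p ≤ 1) (hp : Fintype.card α * p = m) {y : α → ℝ} (hy : ∀ e, 0 ≤ y e) :
    sliceAvg m (fun G => ∏ e ∈ G, y e) ≤
      ((Fintype.card α : ℝ) + 1) * Real.exp (p * ∑ e, (y e - 1)) := by
  have hq : 0 ≤ 1 - p := by linarith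
  set N := Fintype.card α with hN
  have hsum : (∑ G ∈ (Finset.univ : Finset α).powersetCard m, ∏ e ∈ G, y e) *
      (p ^ m * (1 - p) ^ (N - m)) ≤ Real.exp (p * ∑ e, (y e - 1)) := by
    calc _ = ∑ G ∈ (Finset.univ : Finset α).powersetCard m,
          (∏ e ∈ G, (p * y e)) * ∏ e ∈ Gᶜ, (1 - p) := by
          rw [Finset.sum_mul]
          refine Finset.sum_congr rfl fun G hG => ?_
          have hc := card_of_mem_slice hG
          rw [Finset.prod_mul_distrib, Finset.prod_const, Finset.prod_const,
            Finset.card_compl, hc]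
          ring
      _ ≤ ∑ G, (∏ e ∈ G, (p * y e)) * ∏ e ∈ Gᶜ, (1 - p) := by
          refine Finset.sum_le_sum_of_subset_of_nonneg (Finset.subset_univ _) fun G _ _ => ?_
          exact mul_nonneg (Finset.prod_nonneg fun e _ => mul_nonneg hp0 (hy e))
            (Finset.prod_nonneg fun e _ => hq)
      _ = ∏ e, (p * y e + (1 - p)) := (Fintype.prod_add _ _).symm
      _ ≤ ∏ e, Real.exp (p * (y e - 1)) := by
          refine Finset.prod_le_prod (fun e _ => add_nonneg (mul_nonneg hp0 (hy e)) hq)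
            fun e _ => ?_
          have := Real.add_one_le_exp (p * (y e - 1))
          linarith
      _ = _ := by rw [← Real.exp_sum, Finset.mul_sum]
  have hchoose : (0 : ℝ) < N.choose m := by exact_mod_cast Nat.choose_pos hm
  have hone := one_le_succ_mul_choose_mul_pow hm hp0 hp1 hp
  have hS : 0 ≤ ∑ G ∈ (Finset.univ : Finset α).powersetCard m, ∏ e ∈ G, y e :=
    Finset.sum_nonneg fun G _ => Finset.prod_nonneg fun e _ => hy e
  unfold sliceAvg
  rw [div_le_iff₀ hchoose]
  calc _ ≤ (∑ G ∈ (Finset.univ : Finset α).powersetCard m, ∏ e ∈ G, y e) *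
        (((N : ℝ) + 1) * (N.choose m * p ^ m * (1 - p) ^ (N - m))) :=
        le_mul_of_one_le_right hS hone
    _ = ((∑ G ∈ (Finset.univ : Finset α).powersetCard m, ∏ e ∈ G, y e) *
        (p ^ m * (1 - p) ^ (N - m))) * ((N + 1) * N.choose m) := by ring
    _ ≤ Real.exp (p * ∑ e, (y e - 1)) * ((N + 1) * N.choose m) := by gcongr
    _ = _ := by ring

/-- Exponential moment bound for the centred sum of a `±1`-valued function over a uniformly random
`m`-set. -/
theorem sliceAvg_exp_le [DecidableEq α] {m : ℕ} (hm : m ≤ Fintype.card α)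
    (hN : 0 < Fintype.card α) {x : α → ℝ} (hx : ∀ e, |x e| ≤ 1) {t : ℝ} (ht : |t| ≤ 1 / 2) :
    sliceAvg m (fun G => Real.exp
      (t * (∑ e ∈ G, x e - (G.card : ℝ) / Fintype.card α * ∑ e, x e))) ≤
      ((Fintype.card α : ℝ) + 1) * Real.exp (4 * t ^ 2 * m) := by
  set N := Fintype.card α with hNdef
  have hN' : (0 : ℝ) < N := by exact_mod_cast hN
  set a : ℝ := (∑ e, x e) / N with ha
  have hsumx : ∑ e, x e = N * a := by rw [ha]; field_simp
  have habs : |a| ≤ 1 := by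
    rw [ha, abs_div, abs_of_pos hN', div_le_one hN']
    calc _ ≤ ∑ e, |x e| := Finset.abs_sum_le_sum_abs _ _
      _ ≤ ∑ _e : α, (1 : ℝ) := Finset.sum_le_sum fun e _ => hx e
      _ = N := by simp [hNdef]
  have hle := sliceAvg_prod_le (α := α) hm (p := (m : ℝ) / N) (by positivity)
    ((div_le_one hN').2 (by exact_mod_cast hm)) (by rw [← hNdef]; field_simp)
    (y := fun e => Real.exp (t * (x e - a))) (fun e => (Real.exp_pos _).le)
  refine le_trans (le_of_eq ?_) (hle.trans ?_)
  · congr 1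
    funext G
    rw [← Real.exp_sum, ← Finset.mul_sum, Finset.sum_sub_distrib, Finset.sum_const, hsumx,
      nsmul_eq_mul]
    congr 2
    field_simp
  · have hdev : ∀ e, |x e - a| ≤ 2 := fun e => by
      have := abs_sub (x e) a
      linarith [hx e]
    have hpt : ∀ e, Real.exp (t * (x e - a)) - 1 ≤ t * (x e - a) + 4 * t ^ 2 := by
      intro e
      have h1 : |t * (x e - a)| ≤ 1 := by
        rw [abs_mul]
        nlinarith [abs_nonneg t, abs_nonneg (x e - a), hdev e]
      have h2 := (abs_le.1 (Real.abs_exp_sub_one_sub_id_le h1)).2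
      have h3 : (x e - a) ^ 2 ≤ 4 := by
        rw [← sq_abs]
        nlinarith [abs_nonneg (x e - a), hdev e]
      nlinarith [sq_nonneg t]
    have hS : ∑ e, (Real.exp (t * (x e - a)) - 1) ≤ 4 * t ^ 2 * N := by
      calc _ ≤ ∑ e, (t * (x e - a) + 4 * t ^ 2) := Finset.sum_le_sum fun e _ => hpt e
        _ = t * (∑ e, x e - N * a) + 4 * t ^ 2 * N := by
          rw [Finset.sum_add_distrib, ← Finset.mul_sum, Finset.sum_sub_distrib]
          simp [hNdef]
          ring
        _ = _ := by rw [hsumx]; ring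
    refine mul_le_mul_of_nonneg_left (Real.exp_le_exp.2 ?_) (by positivity)
    calc (m : ℝ) / N * ∑ e, (Real.exp (t * (x e - a)) - 1) ≤ m / N * (4 * t ^ 2 * N) := by gcongr
      _ = 4 * t ^ 2 * m := by field_simp

/-- Adding a uniformly random missing element to a uniformly random `m`-set produces a uniformly
random `(m+1)`-set together with a uniformly random element of it. -/
theorem sum_slice_succ [DecidableEq α] (m : ℕ) (F : Finset α → α → ℝ) :
    ∑ H ∈ (Finset.univ : Finset α).powersetCard (m + 1), ∑ e ∈ H, F H e =
      ∑ G ∈ (Finset.univ : Finset α).powersetCard m, ∑ e ∈ Gᶜ, F (insert e G) e := by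
  rw [Finset.sum_sigma', Finset.sum_sigma']
  refine Finset.sum_bij' (fun a _ => ⟨a.1.erase a.2, a.2⟩) (fun a _ => ⟨insert a.2 a.1, a.2⟩)
    ?_ ?_ ?_ ?_ ?_
  · rintro ⟨H, e⟩ h
    simp only [Finset.mem_sigma, Finset.mem_powersetCard, Finset.subset_univ, true_and] at h ⊢
    simp [Finset.card_erase_of_mem h.2, h.1]
  · rintro ⟨G, e⟩ h
    simp only [Finset.mem_sigma, Finset.mem_powersetCard, Finset.subset_univ, true_and,
      Finset.mem_compl] at h ⊢
    simp [Finset.card_insert_of_notMem h.2, h.1]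
  · rintro ⟨H, e⟩ h
    simp only [Finset.mem_sigma] at h
    simp [Finset.insert_erase h.2]
  · rintro ⟨G, e⟩ h
    simp only [Finset.mem_sigma, Finset.mem_compl] at h
    simp [Finset.erase_insert h.2]
  · rintro ⟨H, e⟩ h
    simp only [Finset.mem_sigma] at h
    simp [Finset.insert_erase h.2]

theorem sliceAvg_succ_le [DecidableEq α] {m : ℕ} (hm : m < Fintype.card α)
    (P Q : Finset α → Finset α) (h : ∀ H e, e ∈ H → e ∈ P H → e ∈ Q (H.erase e)) :
    sliceAvg (m + 1) (fun H => ((H ∩ P H).card : ℝ)) / (m + 1 : ℕ) ≤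
      sliceAvg m (fun G => ((Q G \ G).card : ℝ)) / (Fintype.card α - m) := by
  set N := Fintype.card α with hN
  have hS : ∑ H ∈ (Finset.univ : Finset α).powersetCard (m + 1), ((H ∩ P H).card : ℝ) ≤
      ∑ G ∈ (Finset.univ : Finset α).powersetCard m, ((Q G \ G).card : ℝ) := by
    have := sum_slice_succ (α := α) m (fun H e => if e ∈ P H then (1 : ℝ) else 0)
    simp only [Finset.sum_boole, Finset.filter_mem_eq_inter] at this
    rw [this]
    refine Finset.sum_le_sum fun G _ => ?_
    gcongr
    intro e he
    rw [Finset.mem_filter, Finset.mem_compl] at he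
    rw [Finset.mem_sdiff]
    refine ⟨?_, he.1⟩
    simpa [Finset.erase_insert he.1] using h _ e (Finset.mem_insert_self e G) he.2
  have hcast : ((N - m : ℕ) : ℝ) = N - m := by rw [Nat.cast_sub hm.le]
  have hpos : (0 : ℝ) < N - m := by
    rw [← hcast]
    exact_mod_cast Nat.sub_pos_of_lt hm
  have hch : (N.choose (m + 1) : ℝ) * (m + 1) = N.choose m * (N - m) := by
    rw [← hcast]
    exact_mod_cast Nat.choose_succ_right_eq N m
  have hpc : (0 : ℝ) < N.choose m := by exact_mod_cast Nat.choose_pos hm.le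
  unfold sliceAvg
  rw [← hN, div_div, div_div, Nat.cast_succ, hch]
  gcongr

end Slice

section Discrepancy

/-- The pairs of vertices receiving the same colour. -/
def monoPairs {n : ℕ} {α : Type*} (c : Fin n → α) : Finset (EdgeType n) :=
  Finset.univ.filter fun e => (Sym2.map c (e : Sym2 (Fin n))).IsDiag

/-- The product of the signs (given as truth values) of the two endpoints of a pair. -/
def pairSign {n : ℕ} (x : Fin n → Bool) (e : EdgeType n) : ℝ :=
  if (Sym2.map x (e : Sym2 (Fin n))).IsDiag then 1 else -1

/-- The largest deviation of the signed edge count of `G`, over all sign vectors, from what is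
expected for a random graph with as many edges. -/
def discrepancy {n : ℕ} (G : LabeledGraph n) : ℝ :=
  Finset.univ.sup' Finset.univ_nonempty fun x : Fin n → Bool =>
    |∑ e ∈ G, pairSign x e - (G.card : ℝ) / Fintype.card (EdgeType n) * ∑ e, pairSign x e|

theorem card_edgeType (n : ℕ) : Fintype.card (EdgeType n) = n.choose 2 := by
  simpa using Sym2.card_subtype_not_diag (α := Fin n)

theorem abs_pairSign_le {n : ℕ} (x : Fin n → Bool) (e : EdgeType n) : |pairSign x e| ≤ 1 := by
  unfold pairSign
  split_ifs <;> simp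

theorem choose_two_succ_le_two_pow (n : ℕ) : n.choose 2 + 1 ≤ 2 ^ n := by
  induction n with
  | zero => simp
  | succ k ih =>
    have h1 : (k + 1).choose 2 = k + k.choose 2 := by simp [Nat.choose_succ_succ']
    have h2 : k < 2 ^ k := Nat.lt_two_pow_self
    rw [pow_succ]
    omega

theorem card_filter_apply_eq {ι β : Type*} [Fintype ι] [Fintype β] {u v : ι} (h : u ≠ v) :
    Fintype.card β * (Finset.univ.filter fun φ : ι → β => φ u = φ v).card =
      Fintype.card (ι → β) := by
  have h1 : (Finset.univ.filter fun φ : ι → β => φ u = φ v).card =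
      Fintype.card ({j // j ≠ v} → β) := by
    rw [Finset.card_filter,
      Fintype.sum_equiv (Equiv.funSplitAt v β) _
        (fun q => if q.2 ⟨u, h⟩ = q.1 then 1 else 0) (fun φ => by simp [Equiv.funSplitAt]),
      Fintype.sum_prod_type_right]
    simp
  rw [h1, Fintype.card_congr (Equiv.funSplitAt v β), Fintype.card_prod]

theorem sum_sign_comp {n : ℕ} {α : Type*} [Fintype α] (c : Fin n → α) (e : EdgeType n) :
    ∑ s : α → Bool, pairSign (s ∘ c) e =
      if e ∈ monoPairs c then (Fintype.card (α → Bool) : ℝ) else 0 := by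
  obtain ⟨e, he⟩ := e
  induction e using Sym2.ind with
  | _ u v =>
    simp only [pairSign, monoPairs, Finset.mem_filter, Finset.mem_univ, true_and, Sym2.map_mk,
      Sym2.mk_isDiag_iff, Function.comp]
    by_cases h : c u = c v
    · simp [h]
    · have h2 := card_filter_apply_eq (β := Bool) h
      rw [Fintype.card_bool] at h2
      have h3 : ∀ s : α → Bool, (if s (c u) = s (c v) then (1 : ℝ) else -1) =
          2 * (if s (c u) = s (c v) then 1 else 0) - 1 := by
        intro s
        split_ifs <;> norm_num
      rw [if_neg h]
      simp only [h3]
      rw [Finset.sum_sub_distrib, ← Finset.mul_sum, Finset.sum_boole, Finset.sum_const,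
        Finset.card_univ, ← h2, sub_eq_zero, nsmul_eq_mul, mul_one]
      push_cast
      congr!

/-- Edge counts inside any equivalence relation are controlled by the discrepancy: the indicator of
the relation is the average of the products of random signs assigned to its classes. -/
theorem abs_card_inter_monoPairs_sub_le {n : ℕ} {α : Type*} [Fintype α] (c : Fin n → α)
    (G : LabeledGraph n) :
    |((G ∩ monoPairs c).card : ℝ) - (G.card : ℝ) / Fintype.card (EdgeType n) *
      (monoPairs c).card| ≤ discrepancy G := by
  set q : ℝ := (G.card : ℝ) / Fintype.card (EdgeType n) with hq
  set K : ℝ := (Fintype.card (α → Bool) : ℝ) with hK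
  have hKpos : 0 < K := by
    rw [hK]
    exact_mod_cast Fintype.card_pos
  have hset : ∀ A : LabeledGraph n,
      ∑ s : α → Bool, ∑ e ∈ A, pairSign (s ∘ c) e = K * (A ∩ monoPairs c).card := by
    intro A
    rw [Finset.sum_comm]
    simp only [sum_sign_comp]
    rw [← Finset.sum_filter, Finset.filter_mem_eq_inter, Finset.sum_const, nsmul_eq_mul, mul_comm]
  have key : K * (((G ∩ monoPairs c).card : ℝ) - q * (monoPairs c).card) =
      ∑ s : α → Bool, (∑ e ∈ G, pairSign (s ∘ c) e - q * ∑ e, pairSign (s ∘ c) e) := by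
    rw [Finset.sum_sub_distrib, ← Finset.mul_sum, hset, hset, Finset.univ_inter]
    ring
  refine le_of_mul_le_mul_left ?_ hKpos
  calc _ = |K * (((G ∩ monoPairs c).card : ℝ) - q * (monoPairs c).card)| := by
        rw [abs_mul, abs_of_pos hKpos]
    _ ≤ ∑ s : α → Bool, |∑ e ∈ G, pairSign (s ∘ c) e - q * ∑ e, pairSign (s ∘ c) e| := by
        rw [key]
        exact Finset.abs_sum_le_sum_abs _ _
    _ ≤ ∑ _s : α → Bool, discrepancy G := by
        refine Finset.sum_le_sum fun s _ => ?_
        exact Finset.le_sup' (fun x : Fin n → Bool =>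
          |∑ e ∈ G, pairSign x e - q * ∑ e, pairSign x e|) (Finset.mem_univ (s ∘ c))
    _ = _ := by simp [hK]

theorem sliceAvg_discrepancy_le {n m : ℕ} (hn : 1 ≤ n) (hnm : n ≤ m) (hm : m ≤ n.choose 2) :
    sliceAvg m (fun G : LabeledGraph n => discrepancy G) ≤ 8 * Real.sqrt (n * m) := by
  have hm' : m ≤ Fintype.card (EdgeType n) := by rwa [card_edgeType]
  have hn0 : (0 : ℝ) < n := by exact_mod_cast hn
  have hm0 : (0 : ℝ) < m := by exact_mod_cast hn.trans hnm
  have hN : 0 < Fintype.card (EdgeType n) := by omega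
  have hnm' : (n : ℝ) ≤ m := by exact_mod_cast hnm
  set t : ℝ := Real.sqrt (n / m) / 2 with ht
  have htpos : 0 < t := by positivity
  have ht2 : t ≤ 1 / 2 := by
    have : Real.sqrt (n / m) ≤ 1 := by
      exact Real.sqrt_le_one.2 ((div_le_one hm0).2 hnm')
    linarith
  have htsq : 4 * t ^ 2 * m = n := by
    rw [ht, div_pow, Real.sq_sqrt (by positivity)]
    field_simp
    norm_num
  have htprod : t * (8 * Real.sqrt (n * m)) = 4 * n := by
    have : Real.sqrt (n / m) * Real.sqrt (n * m) = n := by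
      rw [← Real.sqrt_mul (by positivity), show (n : ℝ) / m * (n * m) = n ^ 2 by field_simp,
        Real.sqrt_sq hn0.le]
    rw [ht]
    linarith
  let S : (Fin n → Bool) → LabeledGraph n → ℝ := fun x G =>
    ∑ e ∈ G, pairSign x e - (G.card : ℝ) / Fintype.card (EdgeType n) * ∑ e, pairSign x e
  have hpt : ∀ G : LabeledGraph n, discrepancy G * t ≤
      (∑ x, (Real.exp (t * S x G) + Real.exp (-t * S x G))) * Real.exp (-(4 * n)) +
        (4 * n - 1) := by
    intro G
    obtain ⟨x, -, hx⟩ := Finset.exists_mem_eq_sup' (Finset.univ_nonempty)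
      (fun x : Fin n → Bool => |S x G|)
    have hd : discrepancy G = |S x G| := hx
    have h1 : Real.exp (t * |S x G|) ≤ ∑ x, (Real.exp (t * S x G) + Real.exp (-t * S x G)) := by
      refine le_trans ?_ (Finset.single_le_sum
        (f := fun x => Real.exp (t * S x G) + Real.exp (-t * S x G))
        (fun y _ => by positivity) (Finset.mem_univ x))
      rcases abs_cases (S x G) with h | h
      · rw [h.1]
        linarith [Real.exp_pos (-t * S x G)]
      · rw [h.1, mul_neg, ← neg_mul]
        linarith [Real.exp_pos (t * S x G)]
    have h2 := Real.add_one_le_exp (t * |S x G| - 4 * n)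
    rw [sub_eq_add_neg, Real.exp_add] at h2
    have h3 := mul_le_mul_of_nonneg_right h1 (Real.exp_pos (-(4 * (n : ℝ)))).le
    rw [hd]
    linarith
  have hexp : ∀ x : Fin n → Bool, ∀ u : ℝ, |u| ≤ 1 / 2 → u ^ 2 = t ^ 2 →
      sliceAvg m (fun G => Real.exp (u * S x G)) ≤ 2 ^ n * Real.exp n := by
    intro x u hu hut
    refine (sliceAvg_exp_le hm' hN (abs_pairSign_le x) hu).trans ?_
    rw [hut, htsq, card_edgeType]
    gcongr
    exact_mod_cast choose_two_succ_le_two_pow n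
  have htot : sliceAvg m (fun G : LabeledGraph n =>
      ∑ x, (Real.exp (t * S x G) + Real.exp (-t * S x G))) ≤ Real.exp (4 * n) := by
    rw [sliceAvg_sum]
    have htabs : |t| ≤ 1 / 2 := by rwa [abs_of_pos htpos]
    calc _ ≤ ∑ _x : Fin n → Bool, (2 * (2 ^ n * Real.exp n)) := by
          refine Finset.sum_le_sum fun x _ => ?_
          rw [sliceAvg_add]
          linarith [hexp x t htabs rfl, hexp x (-t) (by rwa [abs_neg]) (by ring)]
      _ = 2 * 2 ^ n * 2 ^ n * Real.exp n := by
          simp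
          ring
      _ ≤ 2 ^ n * 2 ^ n * 2 ^ n * Real.exp n := by
          gcongr
          exact le_self_pow₀ (by norm_num) (by omega)
      _ ≤ Real.exp n * Real.exp n * Real.exp n * Real.exp n := by
          have : (2 : ℝ) ^ n ≤ Real.exp n := by
            rw [← mul_one (n : ℝ), Real.exp_nat_mul]
            gcongr
            linarith [Real.add_one_le_exp (1 : ℝ)]
          gcongr
      _ = _ := by
          rw [← Real.exp_add, ← Real.exp_add, ← Real.exp_add]
          ring_nf
  have hmain := sliceAvg_mono (m := m) fun G _ => hpt G
  rw [sliceAvg_mul_const, sliceAvg_add, sliceAvg_mul_const, sliceAvg_const hm'] at hmain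
  have h4 := mul_le_mul_of_nonneg_right htot (Real.exp_pos (-(4 * (n : ℝ)))).le
  rw [← Real.exp_add, add_neg_cancel, Real.exp_zero] at h4
  refine le_of_mul_le_mul_left ?_ htpos
  rw [htprod]
  linarith

end Discrepancy

section Cuts

variable {n r d : ℕ}

theorem mem_monoPairs {α : Type*} {c : Fin n → α} {e : EdgeType n} :
    e ∈ monoPairs c ↔ (Sym2.map c (e : Sym2 (Fin n))).IsDiag := by
  simp [monoPairs]

theorem cutSize_eq_card_sdiff (φ : Fin n → Fin r) (G : LabeledGraph n) :
    cutSize φ G = (G \ monoPairs φ).card := by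
  unfold cutSize
  rw [← Finset.card_map (Function.Embedding.subtype _)]
  congr 1
  ext e
  simp only [Finset.mem_filter, Finset.bind_def, Finset.pure_def, Finset.mem_sup,
    Finset.mem_singleton, Finset.mem_map, Finset.mem_sdiff, mem_monoPairs,
    Function.Embedding.subtype_apply]
  constructor
  · rintro ⟨⟨a, ha, rfl⟩, h⟩
    exact ⟨a, ⟨ha, h⟩, rfl⟩
  · rintro ⟨a, ⟨ha, h⟩, rfl⟩
    exact ⟨⟨a, ha, rfl⟩, h⟩

theorem cutSize_add_card_inter_monoPairs (φ : Fin n → Fin r) (G : LabeledGraph n) :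
    cutSize φ G + (G ∩ monoPairs φ).card = G.card := by
  rw [cutSize_eq_card_sdiff, Finset.card_sdiff_add_card_inter]

theorem cutSize_le_maxCut (φ : Fin n → Fin r) (G : LabeledGraph n) :
    cutSize φ G ≤ maxCut n r G :=
  Finset.le_sup (f := fun φ : Fin n → Fin r => cutSize φ G) (Finset.mem_univ φ)

theorem exists_cutSize_eq_maxCut (hr : 0 < r) (G : LabeledGraph n) :
    ∃ φ : Fin n → Fin r, cutSize φ G = maxCut n r G := by
  have : Nonempty (Fin n → Fin r) := ⟨fun _ => ⟨0, hr⟩⟩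
  obtain ⟨φ, -, h⟩ := Finset.exists_mem_eq_sup Finset.univ Finset.univ_nonempty
    (fun φ : Fin n → Fin r => cutSize φ G)
  exact ⟨φ, h.symm⟩

theorem mem_eqPairs {G : LabeledGraph n} {e : EdgeType n} :
    e ∈ eqPairs d r G ↔ ∀ φ : Fin n → Fin r, deficit r φ G ≤ d → e ∈ monoPairs φ := by
  simp [eqPairs, mem_monoPairs]

/-- Equivalent pairs are the monochromatic pairs of the colouring recording the part of a vertex
in every near-maximum cut. -/
theorem eqPairs_eq_monoPairs (d r : ℕ) (G : LabeledGraph n) :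
    eqPairs d r G =
      monoPairs fun v (φ : {φ : Fin n → Fin r // deficit r φ G ≤ d}) => φ.1 v := by
  ext ⟨e, he⟩
  induction e using Sym2.ind with
  | _ u v => simp [mem_eqPairs, mem_monoPairs, funext_iff]

theorem cutSize_erase {φ : Fin n → Fin r} {H : LabeledGraph n} {e : EdgeType n} (he : e ∈ H) :
    cutSize φ H = cutSize φ (H.erase e) + if e ∈ monoPairs φ then 0 else 1 := by
  rw [cutSize_eq_card_sdiff, cutSize_eq_card_sdiff, Finset.erase_sdiff_comm]
  split_ifs with h
  · rw [Finset.erase_eq_of_notMem (by simp [h]), add_zero]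
  · rw [Finset.card_erase_add_one (by simp [h, he])]

theorem maxCut_le_maxCut_erase {ψ : Fin n → Fin r} {H : LabeledGraph n} {e : EdgeType n}
    (he : e ∈ H) (hψ : cutSize ψ H = maxCut n r H) (heψ : e ∈ monoPairs ψ) :
    maxCut n r H ≤ maxCut n r (H.erase e) := by
  have h := cutSize_erase (φ := ψ) he
  rw [if_pos heψ, add_zero] at h
  rw [← hψ, h]
  exact cutSize_le_maxCut _ _

theorem mem_eqPairs_zero_erase {ψ : Fin n → Fin r} {H : LabeledGraph n} {e : EdgeType n}
    (he : e ∈ H) (hψ : cutSize ψ H = maxCut n r H) (heψ : e ∈ monoPairs ψ) :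
    e ∈ eqPairs 0 r (H.erase e) := by
  rw [mem_eqPairs]
  intro φ hφ
  by_contra hc
  have h1 := cutSize_erase (φ := φ) he
  rw [if_neg hc] at h1
  have h2 := maxCut_le_maxCut_erase he hψ heψ
  have h3 := cutSize_le_maxCut φ H
  unfold deficit at hφ
  omega

theorem mem_eqPairs_succ_erase (hr : 0 < r) {H : LabeledGraph n} {e : EdgeType n}
    (he : e ∈ H) (heq : e ∈ eqPairs d r H) : e ∈ eqPairs (d + 1) r (H.erase e) := by
  rw [mem_eqPairs] at heq ⊢
  intro φ hφ
  by_contra hc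
  obtain ⟨ψ, hψ⟩ := exists_cutSize_eq_maxCut (n := n) hr H
  have h0 : e ∈ monoPairs ψ := heq ψ (by simp [deficit, hψ])
  have h1 := cutSize_erase (φ := φ) he
  rw [if_neg hc] at h1
  have h2 := maxCut_le_maxCut_erase he hψ h0
  refine hc (heq φ ?_)
  unfold deficit at hφ ⊢
  omega

theorem mul_card_inter_monoPairs_le (hr : 0 < r) {G : LabeledGraph n} {φ : Fin n → Fin r}
    (hφ : cutSize φ G = maxCut n r G) : r * (G ∩ monoPairs φ).card ≤ G.card := by
  have hmin : ∀ ψ : Fin n → Fin r, (G ∩ monoPairs φ).card ≤ (G ∩ monoPairs ψ).card := by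
    intro ψ
    have h1 := cutSize_add_card_inter_monoPairs φ G
    have h2 := cutSize_add_card_inter_monoPairs ψ G
    have h3 := cutSize_le_maxCut ψ G
    omega
  have hsum : r * ∑ ψ : Fin n → Fin r, (G ∩ monoPairs ψ).card =
      G.card * Fintype.card (Fin n → Fin r) := by
    have h1 : ∀ ψ : Fin n → Fin r, (G ∩ monoPairs ψ).card =
        ∑ e ∈ G, if e ∈ monoPairs ψ then 1 else 0 := by
      intro ψ
      rw [← Finset.filter_mem_eq_inter, Finset.card_filter]
    simp only [h1]
    rw [Finset.sum_comm, Finset.mul_sum]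
    have h2 : ∀ e ∈ G, r * (∑ ψ : Fin n → Fin r, if e ∈ monoPairs ψ then 1 else 0) =
        Fintype.card (Fin n → Fin r) := by
      rintro ⟨e, he⟩ -
      induction e using Sym2.ind with
      | _ u v =>
        have huv : u ≠ v := by simpa using he
        have h3 := card_filter_apply_eq (β := Fin r) huv
        rw [Fintype.card_fin] at h3
        rw [← Finset.card_filter]
        refine Eq.trans ?_ (h3.trans ?_)
        · congr! with ψ
          simp [mem_monoPairs]
        · congr!
    rw [Finset.sum_congr rfl h2, Finset.sum_const, smul_eq_mul]
  have : Nonempty (Fin n → Fin r) := ⟨fun _ => ⟨0, hr⟩⟩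
  have hpos : 0 < Fintype.card (Fin n → Fin r) := Fintype.card_pos
  refine Nat.le_of_mul_le_mul_right ?_ hpos
  rw [← hsum, mul_assoc]
  refine Nat.mul_le_mul_left _ ?_
  calc _ = ∑ _ψ : Fin n → Fin r, (G ∩ monoPairs φ).card := by
        rw [Finset.sum_const, Finset.card_univ, smul_eq_mul, mul_comm]
    _ ≤ _ := Finset.sum_le_sum fun ψ _ => hmin ψ

theorem two_mul_card_monoPairs_add {α : Type*} (c : Fin n → α) :
    2 * (monoPairs c).card + n =
      (Finset.univ.filter fun p : Fin n × Fin n => c p.1 = c p.2).card := by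
  have h1 : (monoPairs c).card =
      (Finset.univ.filter fun p : Fin n × Fin n => p.1 < p.2 ∧ c p.1 = c p.2).card := by
    have h := Finset.sum_sym2_filter_not_isDiag (Finset.univ : Finset (Fin n))
      (fun e => if (Sym2.map c e).IsDiag then 1 else 0)
    rw [Finset.sum_boole, Finset.sum_boole, Finset.filter_filter, Finset.filter_filter] at h
    simp only [Nat.cast_id] at h
    calc (monoPairs c).card = ((monoPairs c).map (Function.Embedding.subtype _)).card := by simp
      _ = _ := by
        refine Eq.trans (congrArg Finset.card ?_) (h.trans (congrArg Finset.card ?_))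
        · ext e
          simp [mem_monoPairs]
          tauto
        · ext ⟨u, v⟩
          simp only [Finset.mem_filter, Finset.mem_offDiag, Finset.mem_univ, true_and,
            Sym2.map_mk, Sym2.mk_isDiag_iff]
          constructor
          · tauto
          · rintro ⟨h, h'⟩
            exact ⟨h.ne, h, h'⟩
  have h2 : (Finset.univ.filter fun p : Fin n × Fin n => p.2 < p.1 ∧ c p.1 = c p.2).card =
      (Finset.univ.filter fun p : Fin n × Fin n => p.1 < p.2 ∧ c p.1 = c p.2).card := by
    refine Finset.card_equiv (Equiv.prodComm _ _) ?_
    rintro ⟨u, v⟩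
    simp [eq_comm]
  have h3 : (Finset.univ.filter fun p : Fin n × Fin n => p.1 = p.2).card = n := by
    have := Finset.diag_card (Finset.univ : Finset (Fin n))
    rw [Finset.card_univ, Fintype.card_fin] at this
    convert this using 2
    ext ⟨u, v⟩
    simp [Finset.mem_diag]
  have h4 : (Finset.univ.filter fun p : Fin n × Fin n => c p.1 = c p.2) =
      ((Finset.univ.filter fun p : Fin n × Fin n => p.1 < p.2 ∧ c p.1 = c p.2) ∪
      (Finset.univ.filter fun p : Fin n × Fin n => p.2 < p.1 ∧ c p.1 = c p.2)) ∪
      (Finset.univ.filter fun p : Fin n × Fin n => p.1 = p.2) := by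
    ext ⟨u, v⟩
    simp only [Finset.mem_filter, Finset.mem_univ, true_and, Finset.mem_union]
    constructor
    · intro h
      rcases lt_trichotomy u v with h' | h' | h' <;> tauto
    · rintro ((h | h) | h)
      · exact h.2
      · exact h.2
      · rw [h]
  rw [h4, Finset.card_union_of_disjoint, Finset.card_union_of_disjoint, h2, h3, h1]
  · ring
  · rw [Finset.disjoint_left]
    rintro ⟨u, v⟩
    simp only [Finset.mem_filter, Finset.mem_univ, true_and]
    rintro ⟨h, -⟩ ⟨h', -⟩
    exact lt_asymm h h'
  · rw [Finset.disjoint_left]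
    rintro ⟨u, v⟩
    simp only [Finset.mem_filter, Finset.mem_univ, true_and, Finset.mem_union]
    rintro (⟨h, -⟩ | ⟨h, -⟩) heq
    · exact h.ne heq
    · exact h.ne heq.symm

/-- Every partition into `r` parts has at least about a `1/r` fraction of its pairs inside parts. -/
theorem card_monoPairs_ge (hr : 0 < r) (φ : Fin n → Fin r) :
    (n.choose 2 : ℝ) / r - n / 2 ≤ (monoPairs φ).card := by
  have h0 := two_mul_card_monoPairs_add φ
  set s : Fin r → ℝ := fun i => ∑ u, if φ u = i then 1 else 0 with hs
  have h1 : ((2 * (monoPairs φ).card + n : ℕ) : ℝ) = ∑ i, s i ^ 2 := by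
    rw [h0, ← Finset.sum_boole, Fintype.sum_prod_type]
    simp only [hs, sq, Finset.sum_mul_sum]
    symm
    rw [Finset.sum_comm]
    refine Finset.sum_congr rfl fun u _ => ?_
    rw [Finset.sum_comm]
    refine Finset.sum_congr rfl fun v _ => ?_
    simp [eq_comm]
  have h2 : ∑ i, s i = n := by
    simp only [hs]
    rw [Finset.sum_comm]
    simp
  have h3 := sq_sum_le_card_mul_sum_sq (s := (Finset.univ : Finset (Fin r))) (f := s)
  rw [h2, ← h1, Finset.card_univ, Fintype.card_fin] at h3
  push_cast at h3
  have hr' : (1 : ℝ) ≤ r := by exact_mod_cast hr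
  have hc : (n.choose 2 : ℝ) = n * (n - 1) / 2 := Nat.cast_choose_two ℝ n
  rw [hc, sub_le_iff_le_add, div_le_iff₀ (by linarith)]
  have hn : (0 : ℝ) ≤ n := by positivity
  nlinarith

end Cuts

section Rigidity

variable {n r d m : ℕ}

theorem discrepancy_nonneg (G : LabeledGraph n) : 0 ≤ discrepancy G :=
  (abs_nonneg _).trans (abs_card_inter_monoPairs_sub_le (fun _ => ()) G)

theorem sqrt_mul_div_self {x y : ℝ} (hy : 0 < y) :
    Real.sqrt (x * y) / y = Real.sqrt (x / y) := by
  rw [div_eq_iff hy.ne']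
  nth_rewrite 3 [← Real.sqrt_sq hy.le]
  rw [← Real.sqrt_mul' _ (sq_nonneg y)]
  congr 1
  field_simp

theorem sliceAvg_discrepancy_div_le (hn : 1 ≤ n) (hnm : n ≤ m) (hm : m ≤ n.choose 2) :
    sliceAvg m (fun G : LabeledGraph n => discrepancy G) / m ≤ 8 * Real.sqrt ((n : ℝ) / m) := by
  have hm0 : (0 : ℝ) < m := by exact_mod_cast hn.trans hnm
  rw [← sqrt_mul_div_self hm0, ← mul_div_assoc]
  gcongr
  exact sliceAvg_discrepancy_le hn hnm hm

/-- The density of equivalent pairs among the edges of `G`, and among all pairs, is nearly at least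
their density among the non-edges. -/
theorem density_nonedges_le {G : LabeledGraph n} (hG : G.card = m) (hm : 0 < m) {δ : ℝ}
    (hδ : 0 < δ) (hmN : (m : ℝ) ≤ (1 - δ) * n.choose 2) (d r : ℕ) :
    ((eqPairs d r G \ G).card : ℝ) / (n.choose 2 - m) -
        discrepancy G / (m * δ) ≤ ((G ∩ eqPairs d r G).card : ℝ) / m ∧
    ((eqPairs d r G \ G).card : ℝ) / (n.choose 2 - m) -
        discrepancy G / (m * δ) ≤ ((eqPairs d r G).card : ℝ) / n.choose 2 := by
  have hD := abs_card_inter_monoPairs_sub_le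
    (fun v (φ : {φ : Fin n → Fin r // deficit r φ G ≤ d}) => φ.1 v) G
  rw [← eqPairs_eq_monoPairs, card_edgeType, hG] at hD
  have hD0 := discrepancy_nonneg G
  have hT := Finset.card_inter_add_card_sdiff (eqPairs d r G) G
  rw [Finset.inter_comm] at hT
  have hT' : ((G ∩ eqPairs d r G).card : ℝ) +
      ((eqPairs d r G \ G).card : ℝ) = (eqPairs d r G).card := by
    exact_mod_cast hT
  have hm0 : (0 : ℝ) < m := by exact_mod_cast hm
  have hNnn : (0 : ℝ) ≤ n.choose 2 := by positivity
  set N : ℝ := (n.choose 2 : ℝ) with hN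
  set E : ℝ := ((G ∩ eqPairs d r G).card : ℝ)
  set A : ℝ := ((eqPairs d r G \ G).card : ℝ)
  set D := discrepancy G
  rw [← hT'] at hD ⊢
  have hNpos : 0 < N := by
    rcases hNnn.lt_or_eq with h | h
    · exact h
    · rw [← h] at hmN
      linarith
  have hmltN : 0 < N - m := by nlinarith
  have hmle : (m : ℝ) ≤ N := by linarith
  have h1 : (m : ℝ) / N * (E + A) - D ≤ E := by linarith [(abs_le.1 hD).1]
  have h2 : m * A / (N - m) - D / δ ≤ E := by
    have h3 : m * (E + A) - D * N ≤ E * N := by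
      have := mul_le_mul_of_nonneg_right h1 hNpos.le
      rw [sub_mul, show (m : ℝ) / N * (E + A) * N = m * (E + A) by field_simp] at this
      exact this
    have h4 : D * N / (N - m) ≤ D / δ := by
      rw [div_le_div_iff₀ hmltN hδ]
      nlinarith
    have h5 : (m * A - D * N) / (N - m) ≤ E := by
      rw [div_le_iff₀ hmltN]
      nlinarith
    rw [sub_div] at h5
    linarith
  constructor
  · rw [le_div_iff₀ hm0, sub_mul]
    refine le_trans (le_of_eq ?_) h2
    field_simp
  · rw [le_div_iff₀ hNpos, sub_mul]
    have h6 : A / (N - m) * N = A + m * A / (N - m) := by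
      field_simp
      ring
    have h7 : D / δ ≤ D / (m * δ) * N := by
      rw [div_mul_eq_mul_div, div_le_div_iff₀ hδ (by positivity)]
      have : 0 ≤ D * δ * (N - m) := by positivity
      nlinarith
    linarith

theorem half_ratio_le_sqrt (hn : 2 ≤ n) (hm : 0 < m) (hmN : m ≤ n.choose 2) :
    (n : ℝ) / 2 / n.choose 2 ≤ Real.sqrt ((n : ℝ) / m) := by
  have hN : (n.choose 2 : ℝ) = n * (n - 1) / 2 := Nat.cast_choose_two ℝ n
  have hn' : (2 : ℝ) ≤ n := by exact_mod_cast hn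
  have hm0 : (0 : ℝ) < m := by exact_mod_cast hm
  have hmN' : (m : ℝ) ≤ n.choose 2 := by exact_mod_cast hmN
  have hNpos : (0 : ℝ) < n.choose 2 := by linarith
  have hnN : (n : ℝ) ≤ 4 * n.choose 2 := by
    rw [hN]
    nlinarith
  refine Real.le_sqrt_of_sq_le ?_
  rw [div_pow, div_pow, div_div, div_le_div_iff₀ (by positivity) hm0]
  have : (n : ℝ) * m ≤ 2 ^ 2 * (n.choose 2 : ℝ) ^ 2 := by nlinarith
  nlinarith

/-- A random non-edge of `G(n,m)` is equivalent with probability nearly at least `1/r`. -/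
theorem density_nonedges_ge (hn : 2 ≤ n) (hr : 0 < r) {δ : ℝ} (hδ : 0 < δ) (hδ1 : δ ≤ 1) (d : ℕ) :
    ∀ m : ℕ, n ≤ m → ((m : ℝ) + d + 1) ≤ (1 - δ) * n.choose 2 →
      1 / (r : ℝ) - 9 * ((d : ℝ) + 1) / δ * Real.sqrt ((n : ℝ) / m) ≤
        sliceAvg m (fun G : LabeledGraph n =>
          ((eqPairs d r G \ G).card : ℝ)) / (n.choose 2 - m) := by
  have aux : ∀ {m d : ℕ}, n ≤ m → ((m : ℝ) + d + 1) ≤ (1 - δ) * n.choose 2 →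
      m + 1 ≤ n.choose 2 ∧
      Real.sqrt ((n : ℝ) / (m + 1 : ℕ)) ≤ Real.sqrt ((n : ℝ) / m) ∧
      sliceAvg (m + 1) (fun G : LabeledGraph n => discrepancy G) / (m + 1 : ℕ) ≤
        8 * Real.sqrt ((n : ℝ) / m) := by
    intro m d hnm h
    have h1 : m + 1 ≤ n.choose 2 := by
      have : (0 : ℝ) ≤ n.choose 2 := by positivity
      have h' : ((m + 1 : ℕ) : ℝ) ≤ n.choose 2 := by
        push_cast
        nlinarith [(Nat.cast_nonneg d : (0 : ℝ) ≤ d)]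
      exact_mod_cast h'
    have hm0 : (0 : ℝ) < m := by exact_mod_cast (by omega : 0 < m)
    have h2 : Real.sqrt ((n : ℝ) / (m + 1 : ℕ)) ≤ Real.sqrt ((n : ℝ) / m) := by
      gcongr
      simp
    refine ⟨h1, h2, (sliceAvg_discrepancy_div_le (by omega) (by omega) h1).trans ?_⟩
    gcongr
  have hN0 : (0 : ℝ) < n.choose 2 := by exact_mod_cast Nat.choose_pos hn
  induction d with
  | zero =>
    intro m hnm h
    obtain ⟨h1, h2, h3⟩ := aux hnm h
    have hm1 : (0 : ℝ) < (m + 1 : ℕ) := by positivity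
    choose ψ hψ using fun H : LabeledGraph n => exists_cutSize_eq_maxCut (n := n) hr H
    have key := sliceAvg_succ_le (α := EdgeType n) (m := m) (by rw [card_edgeType]; omega)
      (fun H => monoPairs (ψ H)) (fun G => eqPairs 0 r G)
      (fun H e he hP => mem_eqPairs_zero_erase he (hψ H) hP)
    rw [card_edgeType] at key
    refine le_trans ?_ key
    have hpt : ∀ H : LabeledGraph n, H.card = m + 1 →
        1 / (r : ℝ) - (n : ℝ) / 2 / n.choose 2 - discrepancy H / (m + 1 : ℕ) ≤
          ((H ∩ monoPairs (ψ H)).card : ℝ) / (m + 1 : ℕ) := by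
      intro H hH
      have hD := (abs_le.1 (abs_card_inter_monoPairs_sub_le (ψ H) H)).1
      rw [card_edgeType, hH] at hD
      have hM := card_monoPairs_ge hr (ψ H)
      have hM' := mul_le_mul_of_nonneg_left hM
        (by positivity : (0 : ℝ) ≤ (m + 1 : ℕ) / (n.choose 2 : ℝ))
      rw [le_div_iff₀ hm1, sub_mul, div_mul_cancel₀ _ hm1.ne']
      have : ((m + 1 : ℕ) : ℝ) / (n.choose 2 : ℝ) * (n.choose 2 / r - n / 2) =
          (1 / (r : ℝ) - (n : ℝ) / 2 / n.choose 2) * (m + 1 : ℕ) := by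
        have hr0 : (r : ℝ) ≠ 0 := by exact_mod_cast hr.ne'
        field_simp
      linarith
    have havg := sliceAvg_mono (m := m + 1) hpt
    rw [sliceAvg_sub, sliceAvg_const (by rw [card_edgeType]; exact h1), sliceAvg_div_const,
      sliceAvg_div_const] at havg
    have h4 := half_ratio_le_sqrt hn (by omega) h1
    have h5 : 9 * Real.sqrt ((n : ℝ) / m) ≤
        9 * (((0 : ℕ) : ℝ) + 1) / δ * Real.sqrt ((n : ℝ) / m) := by
      gcongr
      rw [le_div_iff₀ hδ]
      push_cast
      linarith
    push_cast at *
    linarith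
  | succ d ih =>
    intro m hnm h
    obtain ⟨h1, h2, h3⟩ := aux hnm h
    have hm1 : (0 : ℝ) < (m + 1 : ℕ) := by positivity
    have ih' := ih (m + 1) (by omega) (by push_cast at h ⊢; linarith)
    have key := sliceAvg_succ_le (α := EdgeType n) (m := m) (by rw [card_edgeType]; omega)
      (fun H => eqPairs d r H) (fun G => eqPairs (d + 1) r G)
      (fun H e he hP => mem_eqPairs_succ_erase hr he hP)
    rw [card_edgeType] at key
    refine le_trans ?_ key
    have hpt := fun (H : LabeledGraph n) (hH : H.card = m + 1) =>
      (density_nonedges_le hH (by omega) hδ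
        (by push_cast at h ⊢; linarith [(Nat.cast_nonneg d : (0 : ℝ) ≤ d)]) d r).1
    have havg := sliceAvg_mono (m := m + 1) hpt
    rw [sliceAvg_sub, sliceAvg_div_const, sliceAvg_div_const, sliceAvg_div_const,
      ← div_div] at havg
    have h4 : sliceAvg (m + 1) (fun G : LabeledGraph n => discrepancy G) / (m + 1 : ℕ) / δ ≤
        9 * Real.sqrt ((n : ℝ) / m) / δ := by
      gcongr
      linarith [Real.sqrt_nonneg ((n : ℝ) / m)]
    have h5 : 9 * ((d : ℝ) + 1) / δ * Real.sqrt ((n : ℝ) / (m + 1 : ℕ)) ≤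
        9 * ((d : ℝ) + 1) / δ * Real.sqrt ((n : ℝ) / m) := by gcongr
    have h6 : 9 * (((d + 1 : ℕ) : ℝ) + 1) / δ * Real.sqrt ((n : ℝ) / m) =
        9 * ((d : ℝ) + 1) / δ * Real.sqrt ((n : ℝ) / m) + 9 * Real.sqrt ((n : ℝ) / m) / δ := by
      push_cast
      ring
    push_cast at *
    linarith

theorem card_eqPairs_div_le (hr : 0 < r) {G : LabeledGraph n} (hG : G.card = m) (hm : 0 < m)
    (hmN : m ≤ n.choose 2) (d : ℕ) :
    ((eqPairs d r G).card : ℝ) / n.choose 2 ≤ 1 / r + discrepancy G / m := by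
  obtain ⟨φ, hφ⟩ := exists_cutSize_eq_maxCut (n := n) hr G
  have hm0 : (0 : ℝ) < m := by exact_mod_cast hm
  have hr0 : (0 : ℝ) < r := by exact_mod_cast hr
  have hN0 : (0 : ℝ) < n.choose 2 := by exact_mod_cast hm.trans_le hmN
  have h1 : ((eqPairs d r G).card : ℝ) ≤ (monoPairs φ).card := by
    exact_mod_cast Finset.card_le_card fun e he => mem_eqPairs.1 he φ (by simp [deficit, hφ])
  have h2 : (r : ℝ) * (G ∩ monoPairs φ).card ≤ m := by
    exact_mod_cast hG ▸ mul_card_inter_monoPairs_le hr hφ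
  have h3 := (abs_le.1 (abs_card_inter_monoPairs_sub_le φ G)).1
  rw [card_edgeType, hG] at h3
  have h4 : ((G ∩ monoPairs φ).card : ℝ) ≤ m / r := by
    rw [le_div_iff₀ hr0]
    linarith
  have h5 : (m : ℝ) * ((eqPairs d r G).card / n.choose 2) ≤ m * (1 / r + discrepancy G / m) := by
    calc _ = (m : ℝ) / n.choose 2 * (eqPairs d r G).card := by ring
      _ ≤ (m : ℝ) / n.choose 2 * (monoPairs φ).card := by gcongr
      _ ≤ m / r + discrepancy G := by linarith
      _ = _ := by field_simp
  exact le_of_mul_le_mul_left h5 hm0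

theorem prGnm_le_sliceAvg {A : LabeledGraph n → Prop} {f : LabeledGraph n → ℝ}
    (hf : ∀ G : LabeledGraph n, G.card = m → 0 ≤ f G)
    (hA : ∀ G : LabeledGraph n, G.card = m → A G → 1 ≤ f G) :
    prGnm n m A ≤ sliceAvg m f := by
  have h : (Finset.univ.filter fun G : LabeledGraph n => G.card = m) =
      (Finset.univ : LabeledGraph n).powersetCard m := by
    ext G
    simp [Finset.mem_powersetCard]
  unfold prGnm sliceAvg
  rw [← Finset.filter_filter, h, ← Finset.sum_boole, Finset.card_powersetCard, Finset.card_univ]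
  gcongr with G hG
  have hc := card_of_mem_slice hG
  split_ifs with hAG
  · exact hA G hc hAG
  · exact hf G hc

theorem prGnm_le_one (n m : ℕ) (A : LabeledGraph n → Prop) : prGnm n m A ≤ 1 := by
  unfold prGnm
  refine div_le_one_of_le₀ ?_ (by positivity)
  refine Nat.cast_le.2 (Finset.card_le_card fun G hG => ?_)
  simp only [Finset.mem_filter, Finset.mem_univ, true_and] at hG ⊢
  exact hG.1

theorem prGnm_not_rigid_le {δ ε : ℝ} (hδ : 0 < δ) (hδ1 : δ ≤ 1) (hε : 0 < ε) (hn : 2 ≤ n)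
    (hr : 0 < r) (hnm : n ≤ m) (hmN : (m : ℝ) + d + 1 ≤ (1 - δ) * n.choose 2) :
    prGnm n m (fun G => ¬ Rigid d r ε G) ≤
      r / ε * (25 * ((d : ℝ) + 1) / δ * Real.sqrt ((n : ℝ) / m)) := by
  have hr0 : (0 : ℝ) < r := by exact_mod_cast hr
  have hm : 0 < m := by omega
  have hm0 : (0 : ℝ) < m := by exact_mod_cast hm
  have hN0 : (0 : ℝ) < n.choose 2 := by exact_mod_cast Nat.choose_pos hn
  have hd0 : (0 : ℝ) ≤ d := by positivity
  have hmle : (m : ℝ) ≤ (1 - δ) * n.choose 2 := by linarith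
  have hmle' : m ≤ n.choose 2 := by
    have : (m : ℝ) ≤ n.choose 2 := by nlinarith
    exact_mod_cast this
  have hcard : m ≤ Fintype.card (EdgeType n) := by rwa [card_edgeType]
  have hpos : ∀ G : LabeledGraph n, G.card = m → 0 ≤
      (1 / r + discrepancy G / m - (eqPairs d r G).card / n.choose 2) * (r / ε) := by
    intro G hG
    have hY := card_eqPairs_div_le hr hG hm hmle' d
    exact mul_nonneg (by linarith) (by positivity)
  have hone : ∀ G : LabeledGraph n, G.card = m → ¬ Rigid d r ε G → 1 ≤
      (1 / r + discrepancy G / m - (eqPairs d r G).card / n.choose 2) * (r / ε) := by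
    intro G hG h
    have hDm : 0 ≤ discrepancy G / m := div_nonneg (discrepancy_nonneg G) hm0.le
    unfold Rigid at h
    rw [not_le, ← div_lt_iff₀ hN0] at h
    have h1 : ε / r ≤ 1 / r + discrepancy G / m - (eqPairs d r G).card / n.choose 2 := by
      have : (1 - ε) / r = 1 / r - ε / r := by ring
      linarith
    calc (1 : ℝ) = ε / r * (r / ε) := by field_simp
      _ ≤ _ := by gcongr
  refine (prGnm_le_sliceAvg hpos hone).trans ?_
  rw [sliceAvg_mul_const, sliceAvg_sub, sliceAvg_add, sliceAvg_const hcard, mul_comm]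
  refine mul_le_mul_of_nonneg_left ?_ (by positivity)
  have h1 := density_nonedges_ge hn hr hδ hδ1 d m hnm hmN
  have h2 := sliceAvg_mono fun (G : LabeledGraph n) (hG : G.card = m) =>
    (density_nonedges_le hG hm hδ hmle d r).2
  rw [sliceAvg_sub, sliceAvg_div_const, sliceAvg_div_const, ← div_div] at h2
  have h3 := sliceAvg_discrepancy_div_le (by omega) hnm hmle'
  set s := Real.sqrt ((n : ℝ) / m)
  have hs : 0 ≤ s := Real.sqrt_nonneg _
  rw [sliceAvg_div_const m (fun G : LabeledGraph n => discrepancy G)]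
  have h4 : sliceAvg m (fun G : LabeledGraph n => discrepancy G) / m / δ ≤ 8 * s / δ := by gcongr
  have hδinv : 8 * s ≤ 8 * s / δ := le_div_self (by positivity) hδ hδ1
  have h5 : 8 * s / δ ≤ 8 * ((d : ℝ) + 1) / δ * s := by
    calc 8 * s / δ = 8 * 1 / δ * s := by ring
      _ ≤ _ := by
        gcongr
        linarith
  have h6 : 25 * ((d : ℝ) + 1) / δ * s = 9 * ((d : ℝ) + 1) / δ * s + 8 * ((d : ℝ) + 1) / δ * s +
      8 * ((d : ℝ) + 1) / δ * s := by ring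
  linarith

end Rigidity

/-- There is an absolute constant `C` such that for all `δ, ε ∈ (0,1)` and all
`d, m, n, r` with `r ≥ 2` and `1 ≤ m ≤ (1-δ) C(n,2)`, the probability that `G(n,m)` is not
`(d,r,ε)`-rigid is at most `(Cr/ε) ((((d+1)/δ) + r) √(n/m) + (n/m)^{1/4})`. -/
theorem prob_not_rigid :
    ∃ C : ℝ, 0 < C ∧
      ∀ (δ ε : ℝ), δ ∈ Set.Ioo (0 : ℝ) 1 → ε ∈ Set.Ioo (0 : ℝ) 1 →
        ∀ d m n r : ℕ, 2 ≤ r → 1 ≤ m → (m : ℝ) ≤ (1 - δ) * (n.choose 2 : ℝ) →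
          prGnm n m (fun G => ¬ Rigid d r ε G) ≤
            C * r / ε *
              ((((d : ℝ) + 1) / δ + r) * Real.sqrt ((n : ℝ) / m) +
                ((n : ℝ) / m) ^ ((1 : ℝ) / 4)) := by
  refine ⟨50, by norm_num, ?_⟩
  intro δ ε hδ hε d m n r hr hm hmN
  obtain ⟨hδ0, hδ1⟩ := hδ
  obtain ⟨hε0, hε1⟩ := hε
  have hm0 : (0 : ℝ) < m := by exact_mod_cast hm
  have hr0 : (2 : ℝ) ≤ r := by exact_mod_cast hr
  have hN0 : (0 : ℝ) < n.choose 2 := by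
    rcases (Nat.cast_nonneg (n.choose 2) : (0 : ℝ) ≤ n.choose 2).lt_or_eq with h | h
    · exact h
    · rw [← h] at hmN
      linarith
  have hn : 2 ≤ n := by
    by_contra hlt
    rw [Nat.choose_eq_zero_of_lt (by omega)] at hN0
    simp at hN0
  have hn0 : (1 : ℝ) ≤ n := by exact_mod_cast (by omega : 1 ≤ n)
  have hx : 0 ≤ (n : ℝ) / m := by positivity
  have hpow : 0 ≤ ((n : ℝ) / m) ^ ((1 : ℝ) / 4) := Real.rpow_nonneg hx _
  have hssq : Real.sqrt ((n : ℝ) / m) ^ 2 = n / m := Real.sq_sqrt hx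
  set s := Real.sqrt ((n : ℝ) / m) with hs
  have hs0 : 0 < s := Real.sqrt_pos.2 (by positivity)
  have hd0 : (0 : ℝ) ≤ d := by positivity
  have hrs : 0 ≤ (r : ℝ) * s := by positivity
  have hbound : 50 * r / ε * (((d : ℝ) + 1) / δ * s) ≤
      50 * r / ε * ((((d : ℝ) + 1) / δ + r) * s + ((n : ℝ) / m) ^ ((1 : ℝ) / 4)) := by
    gcongr
    linarith
  refine le_trans ?_ hbound
  have hrε : 1 ≤ r / ε := by
    rw [le_div_iff₀ hε0]
    linarith
  rcases le_total (1 / 4) (((d : ℝ) + 1) / δ * s) with h | h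
  · refine (prGnm_le_one n m _).trans ?_
    rw [mul_div_assoc]
    nlinarith
  · have hd1 : s ≤ ((d : ℝ) + 1) * s := le_mul_of_one_le_left hs0.le (by linarith)
    have hds : ((d : ℝ) + 1) * s ≤ δ / 4 := by
      rw [div_mul_eq_mul_div, div_le_iff₀ hδ0] at h
      linarith
    have hs1 : s ≤ 1 := by linarith
    have hxs : (n : ℝ) / m ≤ s := by
      rw [← hssq]
      nlinarith
    have hnm : n ≤ m := by
      have : (n : ℝ) ≤ m := (div_le_one hm0).1 (hxs.trans hs1)
      exact_mod_cast this
    have hdm : (d : ℝ) + 1 ≤ δ / 4 * m := by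
      have h1 : 1 ≤ s * m := by
        rw [div_le_iff₀ hm0] at hxs
        linarith
      calc (d : ℝ) + 1 ≤ ((d : ℝ) + 1) * (s * m) := le_mul_of_one_le_right (by positivity) h1
        _ = ((d : ℝ) + 1) * s * m := by ring
        _ ≤ δ / 4 * m := by gcongr
    have hmain := prGnm_not_rigid_le (d := d) (r := r) (half_pos hδ0) (by linarith) hε0 hn
      (by omega) hnm (by nlinarith)
    refine hmain.trans (le_of_eq ?_)
    rw [← hs]
    field_simp
    ring

end
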